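/- For x = (x₁, x₂) ∈ ℝ², define the operator π(x) on 𝒮(ℝ, ℂ) by (π(x)u)(t) = exp(πi·x₁x₂)·exp(2πi·t·x₂)·u(t + x₁). Then for all Schwartz functions f, g, h, k on ℝ, the orthogonality relation ∫_{ℝ²} conj(⟨f, π(x)g⟩)·⟨h, π(x)k⟩ dx = conj(⟨f, h⟩)·⟨g, k⟩ holds, where ⟨u, v⟩ = ∫_ℝ conj(u(t))·v(t) dt is the L² inner product (conjugate-linear in the first argument) and dx is Lebesgue measure on ℝ². -/

import Mathlib

open Complex MeasureTheory

/-- The Heisenberg representation of `ℝ × ℝ^` on functions on `ℝ`: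
`(π(x)u)(t) = exp(πi x₁x₂) exp(2πi t x₂) u(t + x₁)`. -/
noncomputable def heisRep (x : ℝ × ℝ) (u : ℝ → ℂ) : ℝ → ℂ :=
  fun t => Complex.exp ((Real.pi : ℂ) * Complex.I * (x.1 : ℂ) * (x.2 : ℂ)) *
    Complex.exp (2 * (Real.pi : ℂ) * Complex.I * (t : ℂ) * (x.2 : ℂ)) * u (t + x.1)

open scoped FourierTransform ComplexConjugate SchwartzMap

/-- The Schwartz function `t ↦ f(t) conj(g(t + s))`. -/
noncomputable def schwartzShiftProd (f g : 𝓢(ℝ, ℂ)) (s : ℝ) : 𝓢(ℝ, ℂ) :=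
  SchwartzMap.pairing (ContinuousLinearMap.mul ℂ ℂ) f
    (SchwartzMap.postcompCLM (conjCLE : ℂ →L[ℝ] ℂ) (SchwartzMap.compSubConstCLM ℝ (-s) g))

theorem schwartzShiftProd_apply (f g : 𝓢(ℝ, ℂ)) (s t : ℝ) :
    schwartzShiftProd f g s t = f t * conj (g (t + s)) := by
  simp [schwartzShiftProd, SchwartzMap.postcompCLM_apply]

/-- A matrix coefficient of the Heisenberg representation is, up to a phase, the conjugate of the
Fourier transform of a product of translates. -/
theorem integral_conj_mul_heisRep (f g : 𝓢(ℝ, ℂ)) (x : ℝ × ℝ) :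
    ∫ t : ℝ, conj (f t) * heisRep x g t =
      exp ((x.1 * x.2 * Real.pi : ℝ) * I) * conj (𝓕 (schwartzShiftProd f g x.1) x.2) := by
  rw [SchwartzMap.fourier_coe, Real.fourier_real_eq_integral_exp_smul, ← integral_conj,
    ← integral_const_mul]
  congr 1 with t
  simp only [heisRep, schwartzShiftProd_apply, smul_eq_mul, map_mul, ← exp_conj, conj_conj,
    conj_ofReal, conj_I]
  push_cast
  have h₁ : (Real.pi : ℂ) * I * x.1 * x.2 = x.1 * x.2 * Real.pi * I := by ring
  have h₂ : 2 * (Real.pi : ℂ) * I * t * x.2 = -2 * Real.pi * t * x.2 * -I := by ring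
  rw [h₁, h₂]
  ring

theorem conj_integral_heisRep_mul_integral_heisRep (f g h k : 𝓢(ℝ, ℂ)) (x : ℝ × ℝ) :
    conj (∫ t : ℝ, conj (f t) * heisRep x g t) * (∫ t : ℝ, conj (h t) * heisRep x k t) =
      inner ℂ (𝓕 (schwartzShiftProd h k x.1) x.2) (𝓕 (schwartzShiftProd f g x.1) x.2) := by
  rw [integral_conj_mul_heisRep, integral_conj_mul_heisRep, RCLike.inner_apply, map_mul, conj_conj]
  have hphase : conj (exp ((x.1 * x.2 * Real.pi : ℝ) * I)) *
      exp ((x.1 * x.2 * Real.pi : ℝ) * I) = 1 := by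
    rw [conj_mul', norm_exp_ofReal_mul_I]
    simp
  linear_combination (𝓕 (schwartzShiftProd f g x.1) x.2 *
    conj (𝓕 (schwartzShiftProd h k x.1) x.2)) * hphase

theorem aestronglyMeasurable_fourier_schwartzShiftProd (f g : 𝓢(ℝ, ℂ)) :
    AEStronglyMeasurable (fun x : ℝ × ℝ ↦ 𝓕 (schwartzShiftProd f g x.1) x.2) := by
  simp only [SchwartzMap.fourier_coe, Real.fourier_real_eq_integral_exp_smul,
    schwartzShiftProd_apply]
  refine (StronglyMeasurable.integral_prod_right ?_).aestronglyMeasurable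
  have hf := f.continuous
  have hg := g.continuous
  refine Continuous.stronglyMeasurable ?_
  unfold Function.uncurry
  fun_prop

theorem MeasureTheory.Integrable.mul_shift {𝕜 : Type*} [NormedRing 𝕜] {p q : ℝ → 𝕜}
    (hp : Integrable p) (hq : Integrable q) :
    Integrable (fun z : ℝ × ℝ ↦ p z.2 * q (z.2 + z.1)) :=
  (measurePreserving_prod_add_swap volume volume).integrable_comp_of_integrable (hp.mul_prod hq)

theorem integrable_norm_sq_fourier_schwartzShiftProd (f g : 𝓢(ℝ, ℂ)) :
    Integrable (fun x : ℝ × ℝ ↦ ‖𝓕 (schwartzShiftProd f g x.1) x.2‖ ^ 2) := by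
  have hsq (u : 𝓢(ℝ, ℂ)) : Integrable (fun t ↦ ‖u t‖ ^ 2) := 
    (u.memLp 2).integrable_norm_pow two_ne_zero
  refine (integrable_prod_iff
    ((aestronglyMeasurable_fourier_schwartzShiftProd f g).norm.pow 2)).2 ⟨?_, ?_⟩
  · exact .of_forall fun s ↦ hsq (𝓕 (schwartzShiftProd f g s))
  · suffices Integrable (fun s ↦ ∫ ξ, ‖𝓕 (schwartzShiftProd f g s) ξ‖ ^ 2) by simpa using this
    simp only [SchwartzMap.integral_norm_sq_fourier, schwartzShiftProd_apply,
      norm_mul, RCLike.norm_conj, mul_pow]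
    exact ((hsq f).mul_shift (hsq g)).integral_prod_left

theorem integrable_inner_fourier_schwartzShiftProd (f g h k : 𝓢(ℝ, ℂ)) :
    Integrable (fun x : ℝ × ℝ ↦
      inner ℂ (𝓕 (schwartzShiftProd h k x.1) x.2) (𝓕 (schwartzShiftProd f g x.1) x.2)) := by
  refine ((integrable_norm_sq_fourier_schwartzShiftProd h k).add
    (integrable_norm_sq_fourier_schwartzShiftProd f g)).mono'
    ((aestronglyMeasurable_fourier_schwartzShiftProd h k).inner
      (aestronglyMeasurable_fourier_schwartzShiftProd f g)) (.of_forall fun x ↦ ?_)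
  refine (norm_inner_le_norm _ _).trans ?_
  simp only [Pi.add_apply]
  nlinarith [sq_nonneg (‖𝓕 (schwartzShiftProd h k x.1) x.2‖ - ‖𝓕 (schwartzShiftProd f g x.1) x.2‖),
    sq_nonneg ‖𝓕 (schwartzShiftProd h k x.1) x.2‖, sq_nonneg ‖𝓕 (schwartzShiftProd f g x.1) x.2‖]

theorem integral_integral_mul_shift {p q : ℝ → ℂ} (hp : Integrable p) (hq : Integrable q) :
    ∫ s : ℝ, ∫ t : ℝ, p t * q (t + s) = (∫ t, p t) * ∫ t, q t := by
  rw [integral_integral_swap (hp.mul_shift hq)]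
  simp only [integral_const_mul, integral_add_left_eq_self q, integral_mul_const]

/-- Orthogonality relations for the Heisenberg representation: for Schwartz
functions `f, g, h, k` on `ℝ`,
`∫_{ℝ²} conj⟨f, π(x)g⟩ ⟨h, π(x)k⟩ dx = conj⟨f, h⟩ ⟨g, k⟩`,
where `⟨u, v⟩ = ∫ conj(u) v` is the `L²` inner product (conjugate-linear in the
first argument). -/
theorem heisenberg_orthogonality (f g h k : SchwartzMap ℝ ℂ) :
    ∫ x : ℝ × ℝ,
        (starRingEnd ℂ) (∫ t : ℝ, (starRingEnd ℂ) (f t) * heisRep x (⇑g) t) *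
          (∫ t : ℝ, (starRingEnd ℂ) (h t) * heisRep x (⇑k) t)
      = (starRingEnd ℂ) (∫ t : ℝ, (starRingEnd ℂ) (f t) * h t) *
          (∫ t : ℝ, (starRingEnd ℂ) (g t) * k t) := by
  have hconj (u v : 𝓢(ℝ, ℂ)) : Integrable (fun t ↦ conj (u t) * v t) := by
    refine (schwartzShiftProd v u 0).integrable.congr (.of_forall fun t ↦ ?_)
    simp [schwartzShiftProd_apply, mul_comm]
  simp only [conj_integral_heisRep_mul_integral_heisRep]
  rw [Measure.volume_eq_prod,
    integral_prod _ (integrable_inner_fourier_schwartzShiftProd f g h k)]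
  simp only [SchwartzMap.integral_inner_fourier_fourier]
  rw [← integral_conj, ← integral_integral_mul_shift (p := fun t ↦ conj (conj (f t) * h t))
    (by simpa [mul_comm] using hconj h f) (hconj g k)]
  congr 1 with s
  congr 1 with t
  simp only [schwartzShiftProd_apply, RCLike.inner_apply, map_mul, conj_conj]
  ring
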